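/- arXiv:1506.08742 — 3 statements merged into one kernel-verified Lean document; each statement's English description precedes it below -/
import Mathlib

section
/- Semigroup property of the single-level transition operators: let ψ_1, ψ_2 be infinitely differentiable on a neighborhood of [−1,1] and let n ≥ 1. Then for all μ, λ ∈ 𝕁_n the sum ∑_{z ∈ 𝕁_n} T^{ψ_1}_n(μ,z)·T^{ψ_2}_n(z,λ) converges absolutely and equals T^{ψ_1·ψ_2}_n(μ,λ); moreover, with P^ψ_n(λ) := 2^{r_n(r_n−1)/2}·det[⟨J_{λ̃_j,α_n}, (x−1)^{r_n−i}·ψ⟩_{α_n}]_{i,j=1}^{r_n}·dim_n λ, one has ∑_{μ ∈ 𝕁_n} P^{ψ_1}_n(μ)·T^{ψ_2}_n(μ,λ) = P^{ψ_1·ψ_2}_n(λ). -/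
open MeasureTheory Real

/-- Chebyshev polynomials of the second (`α = 1/2`) and third (`α = -1/2`) kind. -/
noncomputable def chebJ (α : ℝ) : ℕ → ℝ → ℝ
  | 0, _ => 1
  | 1, x => if α = 1 / 2 then 2 * x else 2 * x - 1
  | n + 2, x => 2 * x * chebJ α (n + 1) x - chebJ α n x

/-- The normalized inner product `⟨f,g⟩_α`. -/
noncomputable def innerJ (α : ℝ) (f g : ℝ → ℝ) : ℝ :=
  (2 : ℝ) ^ (α + 1 / 2) / Real.pi *
    ∫ x in (-1 : ℝ)..1, f x * g x * (1 - x) ^ α * (1 + x) ^ ((1 : ℝ) / 2)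

/-- `r_n = ⌊(n+1)/2⌋`. -/
def rr (n : ℕ) : ℕ := (n + 1) / 2

/-- `α_n = 1/2` if `n` even, `-1/2` if `n` odd. -/
noncomputable def alph (n : ℕ) : ℝ := if Even n then 1 / 2 else -(1 / 2)

/-- `dim_n λ`. -/
noncomputable def dimSp (n : ℕ) (lam : Fin (rr n) → ℕ) : ℝ :=
  let r : ℕ := rr n
  let L : Fin r → ℝ := fun i => (lam i : ℝ) + (r : ℝ) - (i : ℕ)
  let M : Fin r → ℝ := fun i => (r : ℝ) - (i : ℕ)
  if Even n then
    (∏ i : Fin r, ∏ j ∈ Finset.Ioi i, ((L i) ^ 2 - (L j) ^ 2) / ((M i) ^ 2 - (M j) ^ 2)) *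
      ∏ i : Fin r, L i / M i
  else
    ∏ i : Fin r, ∏ j ∈ Finset.Ioi i,
      ((L i - 1 / 2) ^ 2 - (L j - 1 / 2) ^ 2) / ((M i - 1 / 2) ^ 2 - (M j - 1 / 2) ^ 2)

/-- The single-level transition operator
`T^ψ_n(μ,λ) := det[⟨J_{μ̃_i,α_n}, J_{λ̃_j,α_n}·ψ⟩_{α_n}]·(dim_n λ / dim_n μ)`. -/
noncomputable def Tpsi (ψ : ℝ → ℝ) (n : ℕ) (μ lam : Fin (rr n) → ℕ) : ℝ :=
  Matrix.det (Matrix.of fun i j : Fin (rr n) =>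
    innerJ (alph n) (chebJ (alph n) (μ i + (rr n - 1 - (i : ℕ))))
      (fun x => chebJ (alph n) (lam j + (rr n - 1 - (j : ℕ))) x * ψ x)) *
  (dimSp n lam / dimSp n μ)

/-- The Plancherel-type measure
`P^ψ_n(λ) := 2^{r_n(r_n−1)/2}·det[⟨J_{λ̃_j,α_n},(x−1)^{r_n−i}·ψ⟩_{α_n}]·dim_n λ`. -/
noncomputable def Ppsi (ψ : ℝ → ℝ) (n : ℕ) (lam : Fin (rr n) → ℕ) : ℝ :=
  (2 : ℝ) ^ (rr n * (rr n - 1) / 2) *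
    Matrix.det (Matrix.of fun i j : Fin (rr n) =>
      innerJ (alph n) (chebJ (alph n) (lam j + (rr n - 1 - (j : ℕ))))
        (fun x => (x - 1) ^ (rr n - 1 - (i : ℕ)) * ψ x)) *
    dimSp n lam

theorem HasSum.mul_real {ι κ : Type*} {f : ι → ℝ} {g : κ → ℝ} {a b : ℝ} (hf : HasSum f a)
    (hg : HasSum g b) : HasSum (fun x : ι × κ => f x.1 * g x.2) (a * b) := by
  have hf' : Summable fun i => ‖f i‖ := hf.summable.norm
  have hg' : Summable fun i => ‖g i‖ := hg.summable.norm
  exact hf.mul hg (summable_mul_of_summable_norm hf' hg')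

theorem HasSum.prod_fin {ι : Type*} {r : ℕ} {f : Fin r → ι → ℝ} {a : Fin r → ℝ}
    (h : ∀ i, HasSum (f i) (a i)) :
    HasSum (fun z : Fin r → ι => ∏ i, f i (z i)) (∏ i, a i) := by
  induction r with
  | zero => simp
  | succ r ih =>
    have htail := ih (f := fun i => f i.succ) (a := fun i => a i.succ) fun i => h i.succ
    have hmul := (h 0).mul_real htail
    rw [Fin.prod_univ_succ]
    refine (Equiv.hasSum_iff (Fin.consEquiv fun _ : Fin (r + 1) => ι)).1 ?_
    convert hmul using 1
    ext x
    simp [Fin.prod_univ_succ, Fin.consEquiv]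

/-- An injective tuple is uniquely a permutation of a strictly decreasing one. -/
noncomputable def strictAntiProdPermEquiv (r : ℕ) :
    {z : Fin r → ℕ // StrictAnti z} × Equiv.Perm (Fin r) ≃
      {f : Fin r → ℕ // Function.Injective f} :=
  Equiv.ofBijective (fun p => ⟨p.1.1 ∘ p.2, p.1.2.injective.comp p.2.injective⟩) <| by
    constructor
    · rintro ⟨⟨z, hz⟩, σ⟩ ⟨⟨w, hw⟩, τ⟩ h
      have h : z ∘ σ = w ∘ τ := congrArg Subtype.val h
      have hzw : z = w := by
        have h₁ : (z ∘ σ) ∘ σ.symm = z := by ext; simp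
        have h₂ : (z ∘ σ) ∘ τ.symm = w := by rw [h]; ext; simp
        have heq := Tuple.unique_antitone (f := z ∘ σ) (σ := σ.symm) (τ := τ.symm)
          (by rw [h₁]; exact hz.antitone) (by rw [h₂]; exact hw.antitone)
        rwa [h₁, h₂] at heq
      subst hzw
      have : σ = τ := Equiv.ext fun i => hz.injective (congrFun h i)
      rw [this]
    · rintro ⟨f, hf⟩
      let σ : Equiv.Perm (Fin r) := Fin.revPerm.trans (Tuple.sort f)
      have hanti : Antitone (f ∘ σ) := fun i j hij =>
        Tuple.monotone_sort f (Fin.rev_le_rev.2 hij)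
      refine ⟨(⟨f ∘ σ, hanti.strictAnti_of_injective (hf.comp σ.injective)⟩, σ.symm), ?_⟩
      ext; simp

/-- The Cauchy–Binet formula for products of infinite matrices. -/
theorem hasSum_det_mul_det {r : ℕ} {A : Fin r → ℕ → ℝ} {B : ℕ → Fin r → ℝ}
    {C : Fin r → Fin r → ℝ} (h : ∀ i j, HasSum (fun k => A i k * B k j) (C i j)) :
    HasSum (fun z : {z : Fin r → ℕ // StrictAnti z} =>
      (Matrix.of fun i j => A i (z.1 j)).det * (Matrix.of fun i j => B (z.1 i) j).det)
      (Matrix.of C).det := by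
  have hall : HasSum (fun f : Fin r → ℕ =>
      (Matrix.of fun i j => A i (f j)).det * ∏ i, B (f i) i) (Matrix.of C).det := by
    simp only [Matrix.det_apply', Matrix.of_apply, Finset.sum_mul, mul_assoc,
      ← Finset.prod_mul_distrib]
    exact hasSum_sum fun σ _ => (HasSum.prod_fin fun i => h (σ i) i).mul_left _
  rw [← hasSum_subtype_iff_of_support_subset (s := {f | Function.Injective f})] at hall
  · have hprod := (strictAntiProdPermEquiv r).hasSum_iff.2 hall
    refine hprod.prod_fiberwise fun z => ?_
    have hfin : (Matrix.of fun i j => A i (z.1 j)).det * (Matrix.of fun i j => B (z.1 i) j).det =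
        ∑ σ : Equiv.Perm (Fin r),
          (Matrix.of fun i j => A i (z.1 (σ j))).det * ∏ i, B (z.1 (σ i)) i := by
      rw [Matrix.det_apply' (Matrix.of fun i j => B (z.1 i) j), Finset.mul_sum]
      refine Finset.sum_congr rfl fun σ _ => ?_
      have := Matrix.det_permute' σ (Matrix.of fun i j => A i (z.1 j))
      simp only [Matrix.submatrix, Matrix.of_apply, id] at this
      rw [this]
      simp only [Matrix.of_apply]
      ring
    rw [hfin]
    exact hasSum_fintype _
  · intro f hf
    by_contra hinj
    obtain ⟨i, j, hij, hne⟩ := Function.not_injective_iff.1 hinj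
    refine hf ?_
    dsimp only
    rw [Matrix.det_zero_of_column_eq hne fun k => by simp [hij], zero_mul]

/-- Adding the staircase `r - 1 - i` turns partitions into strictly decreasing tuples. -/
def antitoneEquivStrictAnti (r : ℕ) :
    {l : Fin r → ℕ // Antitone l} ≃ {z : Fin r → ℕ // StrictAnti z} where
  toFun l := ⟨fun i => l.1 i + (r - 1 - (i : ℕ)), fun i j hij => by
    have := l.2 hij.le
    have : (i : ℕ) < j := hij
    dsimp only
    omega⟩
  invFun z := ⟨fun i => z.1 i - (r - 1 - (i : ℕ)), by
    have hz (d : ℕ) (i j : Fin r) (hij : (i : ℕ) + d = j) : z.1 j + d ≤ z.1 i := by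
      induction d generalizing j with
      | zero => simp [Fin.ext (show (i : ℕ) = j by omega)]
      | succ d ih =>
        have h₁ := ih ⟨i + d, by omega⟩ rfl
        have h₂ := z.2 (show (⟨i + d, by omega⟩ : Fin r) < j from Fin.lt_def.2 (by simp; omega))
        omega
    intro i j hij
    have : (i : ℕ) ≤ j := hij
    have := hz (j - i) i j (by omega)
    dsimp only
    omega⟩
  left_inv l := by ext i; simp
  right_inv z := by
    have hz (d : ℕ) (i : Fin r) (hi : (i : ℕ) + d + 1 = r) : d ≤ z.1 i := by
      induction d generalizing i with
      | zero => simp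
      | succ d ih =>
        have h₁ := ih ⟨i + 1, by omega⟩ (by simp; omega)
        have h₂ := z.2 (show i < (⟨i + 1, by omega⟩ : Fin r) from Fin.lt_def.2 (by simp))
        omega
    ext i
    have := hz (r - 1 - i) i (by omega)
    dsimp only
    omega

section Orthonormality

/-- The weight of `innerJ α` relative to the arcsine weight `1 / √(1 - x²)`. -/
noncomputable def chebW (α x : ℝ) : ℝ :=
  (2 : ℝ) ^ (α + 1 / 2) / π * ((1 + x) * if α = 1 / 2 then 1 - x else 1)

theorem chebW_continuous (α : ℝ) : Continuous (chebW α) := by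
  unfold chebW
  split_ifs <;> fun_prop

theorem chebW_nonneg (α : ℝ) {x : ℝ} (hx : x ∈ Set.Icc (-1 : ℝ) 1) : 0 ≤ chebW α x := by
  have h₁ : 0 ≤ 1 + x := by linarith [hx.1]
  have h₂ : 0 ≤ 1 - x := by linarith [hx.2]
  unfold chebW
  split_ifs <;> positivity

theorem chebJ_continuous (α : ℝ) (k : ℕ) : Continuous (chebJ α k) := by
  induction k using Nat.twoStepInduction with
  | zero => simpa [chebJ] using continuous_const
  | one => by_cases h : α = 1 / 2 <;> simp only [chebJ, h, if_true, if_false] <;> fun_prop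
  | more k h₁ h₂ => simp only [chebJ]; fun_prop

theorem innerJ_eq_integral_measureT {α : ℝ} (hα : α = 1 / 2 ∨ α = -(1 / 2)) (f g : ℝ → ℝ) :
    innerJ α f g = ∫ x, f x * g x * chebW α x ∂Polynomial.Chebyshev.measureT := by
  rw [Polynomial.Chebyshev.integral_measureT, innerJ, ← intervalIntegral.integral_const_mul]
  refine intervalIntegral.integral_congr fun x hx => ?_
  rw [Set.uIcc_of_le (by norm_num)] at hx
  have h₁ : 0 ≤ 1 + x := by linarith [hx.1]
  have h₂ : 0 ≤ 1 - x := by linarith [hx.2]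
  have key : (1 - x) ^ α * (1 + x) ^ ((1 : ℝ) / 2) =
      ((1 + x) * if α = 1 / 2 then 1 - x else 1) * √(1 - x ^ 2)⁻¹ := by
    rw [Real.sqrt_inv, show 1 - x ^ 2 = (1 - x) * (1 + x) by ring, Real.sqrt_mul h₂, mul_inv,
      ← Real.sqrt_eq_rpow]
    have e₁ : (1 + x) * (√(1 + x))⁻¹ = √(1 + x) := by
      rw [← div_eq_mul_inv, Real.div_sqrt]
    have e₂ : (1 - x) * (√(1 - x))⁻¹ = √(1 - x) := by
      rw [← div_eq_mul_inv, Real.div_sqrt]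
    rcases hα with rfl | rfl
    · rw [if_pos rfl, ← Real.sqrt_eq_rpow]
      linear_combination (-√(1 + x)) * e₂ - ((1 - x) * (√(1 - x))⁻¹) * e₁
    · rw [if_neg (by norm_num), Real.rpow_neg h₂, ← Real.sqrt_eq_rpow]
      linear_combination (-(√(1 - x))⁻¹) * e₁
  simp only [chebW]
  linear_combination (2 ^ (α + 1 / 2) / π * f x * g x) * key

theorem chebJ_half_cos (k : ℕ) (θ : ℝ) :
    chebJ (1 / 2) k (cos θ) * sin θ = sin ((k + 1) * θ) := by
  induction k using Nat.twoStepInduction with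
  | zero => simp [chebJ]
  | one =>
    simp only [chebJ, if_true]
    norm_num [Real.sin_two_mul]
    ring
  | more k h₁ h₂ =>
    simp only [chebJ]
    push_cast at h₂ ⊢
    have e₁ := Real.sin_add ((k + 1 + 1) * θ) θ
    have e₂ := Real.sin_sub ((k + 1 + 1) * θ) θ
    rw [show ((k : ℝ) + 1 + 1) * θ + θ = (k + 2 + 1) * θ by ring] at e₁
    rw [show ((k : ℝ) + 1 + 1) * θ - θ = (k + 1) * θ by ring] at e₂
    linear_combination 2 * cos θ * h₂ - h₁ - e₁ - e₂

theorem chebJ_neg_half_cos (k : ℕ) (θ : ℝ) :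
    chebJ (-(1 / 2)) k (cos θ) * cos (θ / 2) = cos ((k + 1 / 2) * θ) := by
  induction k using Nat.twoStepInduction with
  | zero => simp [chebJ]; ring_nf
  | one =>
    have e₁ := Real.cos_add θ (θ / 2)
    have e₂ := Real.cos_sub θ (θ / 2)
    rw [show θ - θ / 2 = θ / 2 by ring] at e₂
    simp only [chebJ]
    rw [if_neg (by norm_num), show ((1 : ℕ) + 1 / 2) * θ = θ + θ / 2 by push_cast; ring]
    linear_combination -e₁ - e₂
  | more k h₁ h₂ =>
    simp only [chebJ]
    push_cast at h₂ ⊢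
    have e₁ := Real.cos_add ((k + 1 + 1 / 2) * θ) θ
    have e₂ := Real.cos_sub ((k + 1 + 1 / 2) * θ) θ
    rw [show ((k : ℝ) + 1 + 1 / 2) * θ + θ = (k + 2 + 1 / 2) * θ by ring] at e₁
    rw [show ((k : ℝ) + 1 + 1 / 2) * θ - θ = (k + 1 / 2) * θ by ring] at e₂
    linear_combination 2 * cos θ * h₂ - h₁ - e₁ - e₂

theorem integral_cos_int_mul (m : ℤ) :
    ∫ θ in (0 : ℝ)..π, cos (m * θ) = if m = 0 then π else 0 := by
  split_ifs with h
  · simp [h]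
  · have := Polynomial.Chebyshev.integral_eval_T_real_measureT_of_ne_zero h
    rw [Polynomial.Chebyshev.integral_measureT_eq_integral_cos] at this
    simpa only [Polynomial.Chebyshev.T_real_cos] using this

theorem innerJ_chebJ {α : ℝ} (hα : α = 1 / 2 ∨ α = -(1 / 2)) (k l : ℕ) :
    innerJ α (chebJ α k) (chebJ α l) = if k = l then 1 else 0 := by
  rw [innerJ_eq_integral_measureT hα, Polynomial.Chebyshev.integral_measureT_eq_integral_cos]
  have hint (m : ℤ) : IntervalIntegrable (fun θ : ℝ => cos (m * θ)) volume 0 π :=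
    Continuous.intervalIntegrable (by fun_prop) _ _
  have hkl : ((k : ℤ) - l = 0) ↔ k = l := by omega
  rcases hα with rfl | rfl
  · have key (θ : ℝ) : chebJ (1 / 2) k (cos θ) * chebJ (1 / 2) l (cos θ) * chebW (1 / 2) (cos θ) =
        π⁻¹ * (cos (((k - l : ℤ) : ℝ) * θ) - cos (((k + l + 2 : ℤ) : ℝ) * θ)) := by
      have e₁ := Real.cos_sub ((k + 1) * θ) ((l + 1) * θ)
      have e₂ := Real.cos_add ((k + 1) * θ) ((l + 1) * θ)
      rw [← chebJ_half_cos, ← chebJ_half_cos] at e₁ e₂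
      push_cast
      rw [show ((k : ℝ) - l) * θ = (k + 1) * θ - (l + 1) * θ by ring,
        show ((k : ℝ) + l + 2) * θ = (k + 1) * θ + (l + 1) * θ by ring, e₁, e₂, chebW, if_pos rfl]
      norm_num
      linear_combination (-2 * π⁻¹ * chebJ (1 / 2) k (cos θ) * chebJ (1 / 2) l (cos θ)) *
        Real.sin_sq_add_cos_sq θ
    simp only [key]
    rw [intervalIntegral.integral_const_mul, intervalIntegral.integral_sub (hint _) (hint _),
      integral_cos_int_mul, integral_cos_int_mul, if_neg (show (k : ℤ) + l + 2 ≠ 0 by omega)]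
    simp only [hkl]
    split_ifs <;> simp [Real.pi_ne_zero]
  · have key (θ : ℝ) : chebJ (-(1 / 2)) k (cos θ) * chebJ (-(1 / 2)) l (cos θ) *
        chebW (-(1 / 2)) (cos θ) =
        π⁻¹ * (cos (((k - l : ℤ) : ℝ) * θ) + cos (((k + l + 1 : ℤ) : ℝ) * θ)) := by
      have e₁ := Real.cos_sub ((k + 1 / 2) * θ) ((l + 1 / 2) * θ)
      have e₂ := Real.cos_add ((k + 1 / 2) * θ) ((l + 1 / 2) * θ)
      have e₃ := Real.cos_sq (θ / 2)
      rw [show 2 * (θ / 2) = θ by ring] at e₃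
      rw [← chebJ_neg_half_cos, ← chebJ_neg_half_cos] at e₁ e₂
      push_cast
      rw [show ((k : ℝ) - l) * θ = (k + 1 / 2) * θ - (l + 1 / 2) * θ by ring,
        show ((k : ℝ) + l + 1) * θ = (k + 1 / 2) * θ + (l + 1 / 2) * θ by ring, e₁, e₂, chebW,
        if_neg (by norm_num)]
      norm_num at e₃ ⊢
      linear_combination (-2 * π⁻¹ * chebJ (-(1 / 2)) k (cos θ) * chebJ (-(1 / 2)) l (cos θ)) * e₃
    simp only [key]
    rw [intervalIntegral.integral_const_mul, intervalIntegral.integral_add (hint _) (hint _),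
      integral_cos_int_mul, integral_cos_int_mul, if_neg (show (k : ℤ) + l + 1 ≠ 0 by omega)]
    simp only [hkl]
    split_ifs <;> simp [Real.pi_ne_zero]

end Orthonormality

section Parseval

/-- The measure on `[-1, 1]` whose inner product is `innerJ α`. -/
noncomputable def chebMeasure (α : ℝ) : Measure (Set.Icc (-1 : ℝ) 1) :=
  (Polynomial.Chebyshev.measureT.comap Subtype.val).withDensity
    fun x => ENNReal.ofReal (chebW α x)

theorem measureT_restrict_Icc :
    Polynomial.Chebyshev.measureT.restrict (Set.Icc (-1) 1) = Polynomial.Chebyshev.measureT := by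
  rw [Polynomial.Chebyshev.measureT, Measure.restrict_restrict measurableSet_Icc,
    Set.inter_eq_self_of_subset_right Set.Ioc_subset_Icc_self]

instance (α : ℝ) : IsFiniteMeasure (chebMeasure α) := by
  refine isFiniteMeasure_withDensity_ofReal (Integrable.hasFiniteIntegral ?_)
  have : Integrable (chebW α ∘ Subtype.val)
      (Polynomial.Chebyshev.measureT.comap (Subtype.val : Set.Icc (-1 : ℝ) 1 → ℝ)) := by
    rw [← integrableOn_iff_comap_subtypeVal measurableSet_Icc]
    exact (Polynomial.Chebyshev.integrable_measureT (chebW_continuous α).continuousOn).integrableOn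
  exact this

theorem integral_chebMeasure {α : ℝ} (hα : α = 1 / 2 ∨ α = -(1 / 2)) (f g : ℝ → ℝ) :
    ∫ x : Set.Icc (-1 : ℝ) 1, f x * g x ∂chebMeasure α = innerJ α f g := by
  have hmeas : Measurable fun x : Set.Icc (-1 : ℝ) 1 => ENNReal.ofReal (chebW α x) :=
    ((chebW_continuous α).measurable.comp measurable_subtype_coe).ennreal_ofReal
  rw [chebMeasure, integral_withDensity_eq_integral_toReal_smul hmeas (by simp),
    innerJ_eq_integral_measureT hα, ← measureT_restrict_Icc,
    ← integral_subtype_comap measurableSet_Icc, measureT_restrict_Icc]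
  refine integral_congr_ae (Filter.Eventually.of_forall fun x => ?_)
  simp only [ENNReal.toReal_ofReal (chebW_nonneg α x.2), smul_eq_mul]
  ring

/-- `chebJ α k` as a continuous function on `[-1, 1]`. -/
noncomputable def chebC (α : ℝ) (k : ℕ) : C(Set.Icc (-1 : ℝ) 1, ℝ) :=
  ⟨fun x => chebJ α k x, (chebJ_continuous α k).comp continuous_subtype_val⟩

theorem span_chebC_topologicalClosure (α : ℝ) :
    (Submodule.span ℝ (Set.range (chebC α))).topologicalClosure = ⊤ := by
  set S := Submodule.span ℝ (Set.range (chebC α))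
  have hmem (k : ℕ) : chebC α k ∈ S := Submodule.subset_span ⟨k, rfl⟩
  let X : C(Set.Icc (-1 : ℝ) 1, ℝ) := ⟨fun x => x, continuous_subtype_val⟩
  have hX (f : C(Set.Icc (-1 : ℝ) 1, ℝ)) (hf : f ∈ S) : X * f ∈ S := by
    induction hf using Submodule.span_induction with
    | mem f hf =>
      obtain ⟨k, rfl⟩ := hf
      cases k with
      | zero =>
        by_cases h : α = 1 / 2
        · convert S.smul_mem (1 / 2) (hmem 1) using 1
          ext x
          simp [X, chebC, chebJ, h]
        · convert S.smul_mem (1 / 2) (S.add_mem (hmem 1) (hmem 0)) using 1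
          ext x
          rw [one_div] at h
          simp [X, chebC, chebJ, h]
          ring
      | succ k =>
        convert S.smul_mem (1 / 2) (S.add_mem (hmem (k + 2)) (hmem k)) using 1
        ext x
        simp [X, chebC, chebJ]
        ring
    | zero => simp
    | add f g _ _ hf hg => rw [mul_add]; exact S.add_mem hf hg
    | smul c f _ hf => rw [mul_smul_comm]; exact S.smul_mem c hf
  have hpow (m : ℕ) : X ^ m ∈ S := by
    induction m with
    | zero =>
      convert hmem 0 using 1
      ext x
      simp [chebC, chebJ]
    | succ m ih => rw [pow_succ']; exact hX _ ih
  have hpoly : (polynomialFunctions (Set.Icc (-1 : ℝ) 1) : Set C(Set.Icc (-1 : ℝ) 1, ℝ)) ⊆ S := by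
    rw [polynomialFunctions_coe]
    rintro _ ⟨p, rfl⟩
    induction p using Polynomial.induction_on' with
    | add p q hp hq => rw [map_add]; exact S.add_mem hp hq
    | monomial m c =>
      have : Polynomial.toContinuousMapOnAlgHom (Set.Icc (-1 : ℝ) 1) (Polynomial.monomial m c) =
          c • X ^ m := by
        ext x
        simp [X]
      rw [this]
      exact S.smul_mem c (hpow m)
  have htop := congrArg
    (fun A : Subalgebra ℝ C(Set.Icc (-1 : ℝ) 1, ℝ) => (A : Set C(Set.Icc (-1 : ℝ) 1, ℝ)))
    (polynomialFunctions_closure_eq_top (-1) 1)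
  simp only [Subalgebra.topologicalClosure_coe, Algebra.coe_top] at htop
  refine SetLike.coe_injective ?_
  rw [Submodule.topologicalClosure_coe, Submodule.top_coe]
  exact Set.univ_subset_iff.1 (htop ▸ closure_mono hpoly)

/-- Parseval's identity for the orthonormal polynomials `chebJ α`. -/
theorem hasSum_innerJ_mul_innerJ {α : ℝ} (hα : α = 1 / 2 ∨ α = -(1 / 2)) {f g : ℝ → ℝ}
    (hf : ContinuousOn f (Set.Icc (-1) 1)) (hg : ContinuousOn g (Set.Icc (-1) 1)) :
    HasSum (fun k => innerJ α f (chebJ α k) * innerJ α (chebJ α k) g) (innerJ α f g) := by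
  let e (k : ℕ) : Lp ℝ 2 (chebMeasure α) := ContinuousMap.toLp 2 (chebMeasure α) ℝ (chebC α k)
  have hinner (u v : C(Set.Icc (-1 : ℝ) 1, ℝ)) (f g : ℝ → ℝ) (hu : ∀ x, u x = f x)
      (hv : ∀ x, v x = g x) :
      inner ℝ (ContinuousMap.toLp 2 (chebMeasure α) ℝ u) (ContinuousMap.toLp 2 (chebMeasure α) ℝ v)
        = innerJ α f g := by
    rw [ContinuousMap.inner_toLp, ← integral_chebMeasure hα]
    simp [hu, hv, mul_comm]
  have horth : Orthonormal ℝ e := by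
    rw [orthonormal_iff_ite]
    intro k l
    rw [hinner _ _ (chebJ α k) (chebJ α l) (fun _ => rfl) fun _ => rfl, innerJ_chebJ hα]
  have hspan : (Submodule.span ℝ (Set.range e)).topologicalClosure = ⊤ := by
    have := (ContinuousMap.toLp_denseRange ℝ (chebMeasure α) ℝ
      (p := 2) (by simp)).topologicalClosure_map_submodule (span_chebC_topologicalClosure α)
    rw [Submodule.map_span, ← Set.range_comp] at this
    exact this
  have h := (HilbertBasis.mk horth hspan.ge).hasSum_inner_mul_inner
    (ContinuousMap.toLp 2 (chebMeasure α) ℝ ⟨_, hf.domRestrict⟩)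
    (ContinuousMap.toLp 2 (chebMeasure α) ℝ ⟨_, hg.domRestrict⟩)
  rw [hinner _ _ f g (fun _ => rfl) fun _ => rfl, HilbertBasis.coe_mk] at h
  have hterm (k : ℕ) :
      inner ℝ (ContinuousMap.toLp 2 (chebMeasure α) ℝ ⟨_, hf.domRestrict⟩) (e k) *
        inner ℝ (e k) (ContinuousMap.toLp 2 (chebMeasure α) ℝ ⟨_, hg.domRestrict⟩) =
      innerJ α f (chebJ α k) * innerJ α (chebJ α k) g := by
    rw [hinner _ _ f (chebJ α k) (fun _ => rfl) fun _ => rfl,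
      hinner _ _ (chebJ α k) g (fun _ => rfl) fun _ => rfl]
  simp only [hterm] at h
  exact h

end Parseval

theorem alph_eq (n : ℕ) : alph n = 1 / 2 ∨ alph n = -(1 / 2) := by
  unfold alph
  split_ifs <;> simp

theorem prod_Ioi_sq_sub_sq_div_ne_zero {r : ℕ} {L M : Fin r → ℝ} (hL : StrictAnti L)
    (hM : StrictAnti M) (hL0 : ∀ i, 0 < L i) (hM0 : ∀ i, 0 < M i) :
    ∏ i : Fin r, ∏ j ∈ Finset.Ioi i, (L i ^ 2 - L j ^ 2) / (M i ^ 2 - M j ^ 2) ≠ 0 := by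
  refine Finset.prod_ne_zero_iff.2 fun i _ => Finset.prod_ne_zero_iff.2 fun j hj => ?_
  rw [Finset.mem_Ioi] at hj
  refine div_ne_zero ?_ ?_
  · nlinarith [hL hj, hL0 j]
  · nlinarith [hM hj, hM0 j]

theorem dimSp_ne_zero (n : ℕ) {l : Fin (rr n) → ℕ} (hl : Antitone l) : dimSp n l ≠ 0 := by
  have hlt (i : Fin (rr n)) : ((i : ℕ) : ℝ) + 1 ≤ rr n := by exact_mod_cast i.2
  have hL : StrictAnti fun i : Fin (rr n) => (l i : ℝ) + (rr n : ℝ) - (i : ℕ) := fun i j hij => by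
    have h₁ : (l j : ℝ) ≤ l i := by exact_mod_cast hl hij.le
    have h₂ : ((i : ℕ) : ℝ) < (j : ℕ) := by exact_mod_cast hij
    dsimp only
    linarith
  have hM : StrictAnti fun i : Fin (rr n) => (rr n : ℝ) - (i : ℕ) := fun i j hij => by
    have h₂ : ((i : ℕ) : ℝ) < (j : ℕ) := by exact_mod_cast hij
    dsimp only
    linarith
  have hL1 (i : Fin (rr n)) : 1 ≤ (l i : ℝ) + (rr n : ℝ) - (i : ℕ) := by
    have := (l i).cast_nonneg (α := ℝ)
    linarith [hlt i]
  have hM1 (i : Fin (rr n)) : 1 ≤ (rr n : ℝ) - (i : ℕ) := by linarith [hlt i]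
  by_cases hn : Even n
  · simp only [dimSp, if_pos hn]
    refine mul_ne_zero ?_ (Finset.prod_ne_zero_iff.2 fun i _ => ?_)
    · exact prod_Ioi_sq_sub_sq_div_ne_zero hL hM (fun i => one_pos.trans_le (hL1 i))
        fun i => one_pos.trans_le (hM1 i)
    · exact div_ne_zero (one_pos.trans_le (hL1 i)).ne' (one_pos.trans_le (hM1 i)).ne'
  · simp only [dimSp, if_neg hn]
    have hL' (i : Fin (rr n)) : 0 < (l i : ℝ) + (rr n : ℝ) - (i : ℕ) - 1 / 2 := by
      linarith [hL1 i]
    have hM' (i : Fin (rr n)) : 0 < (rr n : ℝ) - (i : ℕ) - 1 / 2 := by linarith [hM1 i]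
    exact prod_Ioi_sq_sub_sq_div_ne_zero (fun i j hij => sub_lt_sub_right (hL hij) _)
      (fun i j hij => sub_lt_sub_right (hM hij) _) hL' hM'

theorem innerJ_congr {α : ℝ} {f g f' g' : ℝ → ℝ} (h : ∀ x, f x * g x = f' x * g' x) :
    innerJ α f g = innerJ α f' g' := by
  simp only [innerJ, h]

/-- Cauchy–Binet for the determinants of Gram-type matrices of the polynomials `chebJ`. -/
theorem hasSum_det_innerJ {r : ℕ} {α : ℝ} (hα : α = 1 / 2 ∨ α = -(1 / 2))
    {u v : Fin r → ℝ → ℝ} (hu : ∀ i, ContinuousOn (u i) (Set.Icc (-1) 1))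
    (hv : ∀ i, ContinuousOn (v i) (Set.Icc (-1) 1)) :
    HasSum (fun l : {l : Fin r → ℕ // Antitone l} =>
      (Matrix.of fun i j => innerJ α (u i) (chebJ α (l.1 j + (r - 1 - (j : ℕ))))).det *
      (Matrix.of fun i j => innerJ α (chebJ α (l.1 i + (r - 1 - (i : ℕ)))) (v j)).det)
      (Matrix.of fun i j => innerJ α (u i) (v j)).det := by
  have h := hasSum_det_mul_det (A := fun i k => innerJ α (u i) (chebJ α k))
    (B := fun k j => innerJ α (chebJ α k) (v j)) (C := fun i j => innerJ α (u i) (v j))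
    fun i j => hasSum_innerJ_mul_innerJ hα (hu i) (hv j)
  have hsum := (antitoneEquivStrictAnti r).hasSum_iff.2 h
  exact hsum

/-- Semigroup property of the single-level transition operators:
`T^{ψ₁}_n T^{ψ₂}_n = T^{ψ₁ψ₂}_n` and `P^{ψ₁}_n T^{ψ₂}_n = P^{ψ₁ψ₂}_n`. -/
theorem transition_semigroup (ψ₁ ψ₂ : ℝ → ℝ) (U : Set ℝ) (hU : IsOpen U)
    (hsub : Set.Icc (-1 : ℝ) 1 ⊆ U)
    (hψ₁ : ContDiffOn ℝ (⊤ : ℕ∞) ψ₁ U) (hψ₂ : ContDiffOn ℝ (⊤ : ℕ∞) ψ₂ U)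
    (n : ℕ) (hn : 1 ≤ n)
    (μ lam : { l : Fin (rr n) → ℕ // Antitone l }) :
    HasSum
      (fun z : { l : Fin (rr n) → ℕ // Antitone l } =>
        Tpsi ψ₁ n μ.1 z.1 * Tpsi ψ₂ n z.1 lam.1)
      (Tpsi (fun x => ψ₁ x * ψ₂ x) n μ.1 lam.1) ∧
    HasSum
      (fun z : { l : Fin (rr n) → ℕ // Antitone l } =>
        Ppsi ψ₁ n z.1 * Tpsi ψ₂ n z.1 lam.1)
      (Ppsi (fun x => ψ₁ x * ψ₂ x) n lam.1) := by
  have hc₁ : ContinuousOn ψ₁ (Set.Icc (-1) 1) := hψ₁.continuousOn.mono hsub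
  have hc₂ : ContinuousOn ψ₂ (Set.Icc (-1) 1) := hψ₂.continuousOn.mono hsub
  have hv (i : Fin (rr n)) : ContinuousOn
      (fun x => chebJ (alph n) (lam.1 i + (rr n - 1 - (i : ℕ))) x * ψ₂ x) (Set.Icc (-1) 1) :=
    (chebJ_continuous _ _).continuousOn.mul hc₂
  constructor
  · have h := (hasSum_det_innerJ (alph_eq n) (u := fun (i : Fin (rr n)) x =>
      chebJ (alph n) (μ.1 i + (rr n - 1 - (i : ℕ))) x * ψ₁ x)
      (fun i => (chebJ_continuous _ _).continuousOn.mul hc₁) hv).mul_right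
      (dimSp n lam.1 / dimSp n μ.1)
    convert h using 1
    · rfl
    · funext z
      have hz := dimSp_ne_zero n z.2
      simp only [Tpsi]
      rw [show (Matrix.of fun i j : Fin (rr n) =>
          innerJ (alph n) (chebJ (alph n) (μ.1 i + (rr n - 1 - (i : ℕ))))
            fun x => chebJ (alph n) (z.1 j + (rr n - 1 - (j : ℕ))) x * ψ₁ x) =
          Matrix.of fun i j => innerJ (alph n)
            (fun x => chebJ (alph n) (μ.1 i + (rr n - 1 - (i : ℕ))) x * ψ₁ x)
            (chebJ (alph n) (z.1 j + (rr n - 1 - (j : ℕ)))) from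
        Matrix.ext fun i j => innerJ_congr fun x => by ring]
      field_simp
    · rw [Tpsi]
      congr 2
      exact Matrix.ext fun i j => innerJ_congr fun x => by ring
  · have h := ((hasSum_det_innerJ (alph_eq n) (u := fun (i : Fin (rr n)) x =>
      (x - 1) ^ (rr n - 1 - (i : ℕ)) * ψ₁ x)
      (fun i => (by fun_prop : Continuous fun x : ℝ =>
        (x - 1) ^ (rr n - 1 - (i : ℕ))).continuousOn.mul hc₁) hv).mul_left
      ((2 : ℝ) ^ (rr n * (rr n - 1) / 2))).mul_right (dimSp n lam.1)
    convert h using 1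
    · rfl
    · funext z
      have hz := dimSp_ne_zero n z.2
      simp only [Ppsi, Tpsi]
      rw [show (Matrix.of fun i j : Fin (rr n) =>
          innerJ (alph n) (chebJ (alph n) (z.1 j + (rr n - 1 - (j : ℕ))))
            fun x => (x - 1) ^ (rr n - 1 - (i : ℕ)) * ψ₁ x) =
          Matrix.of fun i j : Fin (rr n) => innerJ (alph n)
            (fun x => (x - 1) ^ (rr n - 1 - (i : ℕ)) * ψ₁ x)
            (chebJ (alph n) (z.1 j + (rr n - 1 - (j : ℕ)))) from
        Matrix.ext fun i j => innerJ_congr fun x => mul_comm _ _]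
      field_simp
    · rw [Ppsi]
      congr 3
      exact Matrix.ext fun i j => innerJ_congr fun x => by ring
end

section
/- Tridiagonal determinant formula: let q ≥ 1, let p_0 > p_1 ≥ 0 be reals and p_2 ≥ 0 a real. Let A_q be the q×q matrix with diagonal entries equal to p_0 except the (q,q) entry equal to p_0 + p_2, with super- and sub-diagonal entries equal to p_1/2, and all other entries 0. Then det A_q = [h_q(r_+) − h_q(r_−) + p_2·(r_+^q − r_−^q)] / √(p_0² − p_1²), where r_± := (p_0 ± √(p_0² − p_1²))/2 and h_n(x) := p_0·x^n − (p_1²/4)·x^{n−1}. -/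
/-- Two-step expansion of a determinant whose first row and first column vanish beyond their
first two entries. -/
theorem det_eq_of_first_row_col_eq_zero {R : Type*} [CommRing R] {n : ℕ}
    (A : Matrix (Fin (n + 2)) (Fin (n + 2)) R)
    (hrow : ∀ j : Fin n, A 0 j.succ.succ = 0) (hcol : ∀ i : Fin n, A i.succ.succ 0 = 0) :
    A.det = A 0 0 * (A.submatrix Fin.succ Fin.succ).det -
      A 0 1 * A 1 0 *
        (A.submatrix (fun i : Fin n => i.succ.succ) (fun j : Fin n => j.succ.succ)).det := by
  have hminor : (A.submatrix Fin.succ (Fin.succAbove 1)).det =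
      A 1 0 *
        (A.submatrix (fun i : Fin n => i.succ.succ) (fun j : Fin n => j.succ.succ)).det := by
    rw [Matrix.det_succ_column_zero, Fin.sum_univ_succ, Finset.sum_eq_zero]
    · have hsub : (A.submatrix Fin.succ (Fin.succAbove 1)).submatrix (Fin.succAbove 0) Fin.succ =
          A.submatrix (fun i : Fin n => i.succ.succ) (fun j : Fin n => j.succ.succ) := by
        ext i j
        have hj : Fin.succAbove 1 j.succ = j.succ.succ := by
          rw [← Fin.succ_zero_eq_one, Fin.succ_succAbove_succ, Fin.succAbove_zero]
        simp only [Matrix.submatrix_apply, Fin.succAbove_zero, hj]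
      rw [hsub]
      simp
    · intro i _
      simp [hcol]
  rw [Matrix.det_succ_row_zero, Fin.sum_univ_succ, Fin.sum_univ_succ, Finset.sum_eq_zero]
  · rw [Fin.succ_zero_eq_one, hminor]
    simp
    ring
  · intro j _
    simp [hrow]

/-- The tridiagonal Toeplitz matrix with diagonal `a` and off-diagonals `b`, whose last diagonal
entry is perturbed by `e`. -/
def tridiagonalMatrix (a b e : ℝ) (n : ℕ) : Matrix (Fin n) (Fin n) ℝ :=
  Matrix.of fun i j : Fin n =>
    if i = j then (if (i : ℕ) = n - 1 then a + e else a)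
    else if (i : ℕ) + 1 = (j : ℕ) ∨ (j : ℕ) + 1 = (i : ℕ) then b else 0

theorem tridiagonalMatrix_submatrix_succ (a b e : ℝ) (n : ℕ) :
    (tridiagonalMatrix a b e (n + 1)).submatrix Fin.succ Fin.succ = tridiagonalMatrix a b e n := by
  ext i j
  have hi : (i : ℕ) + 1 = n ↔ (i : ℕ) = n - 1 := by have := i.isLt; omega
  simp [tridiagonalMatrix, hi]

theorem det_tridiagonalMatrix_add_two (a b e : ℝ) (n : ℕ) :
    (tridiagonalMatrix a b e (n + 2)).det =
      a * (tridiagonalMatrix a b e (n + 1)).det - b ^ 2 * (tridiagonalMatrix a b e n).det := by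
  have hsub : (tridiagonalMatrix a b e (n + 2)).submatrix
      (fun i : Fin n => i.succ.succ) (fun j : Fin n => j.succ.succ) =
      tridiagonalMatrix a b e n := by
    rw [← tridiagonalMatrix_submatrix_succ a b e n,
      ← tridiagonalMatrix_submatrix_succ a b e (n + 1)]
    rfl
  rw [det_eq_of_first_row_col_eq_zero, tridiagonalMatrix_submatrix_succ, hsub]
  · have h00 : tridiagonalMatrix a b e (n + 2) 0 0 = a := by simp [tridiagonalMatrix]
    have h01 : tridiagonalMatrix a b e (n + 2) 0 1 = b := by simp [tridiagonalMatrix]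
    have h10 : tridiagonalMatrix a b e (n + 2) 1 0 = b := by simp [tridiagonalMatrix]
    rw [h00, h01, h10, sq]
  · intro j
    simp [tridiagonalMatrix, Fin.ext_iff]
  · intro i
    simp [tridiagonalMatrix, Fin.ext_iff]

/-- Closed form of the determinant in terms of the roots `r`, `s` of `x ^ 2 - a * x + b ^ 2`. -/
theorem sub_mul_det_tridiagonalMatrix (b e r s : ℝ) (hb : r * s = b ^ 2) (n : ℕ) :
    (r - s) * (tridiagonalMatrix (r + s) b e (n + 1)).det =
      (r + s) * r ^ (n + 1) - b ^ 2 * r ^ n - ((r + s) * s ^ (n + 1) - b ^ 2 * s ^ n) +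
        e * (r ^ (n + 1) - s ^ (n + 1)) := by
  have h1 : (tridiagonalMatrix (r + s) b e 1).det = r + s + e := by
    simp [tridiagonalMatrix]
  induction n using Nat.twoStepInduction with
  | zero => rw [h1]; ring
  | one =>
    rw [det_tridiagonalMatrix_add_two, h1, Matrix.det_fin_zero, ← hb]
    ring
  | more n ih₀ ih₁ =>
    rw [det_tridiagonalMatrix_add_two, mul_sub, mul_left_comm, ih₁, mul_left_comm, ih₀, ← hb]
    ring


/-- Tridiagonal determinant formula: `A_q` has diagonal entries `p₀` except the
last one `p₀ + p₂`, super- and sub-diagonal entries `p₁/2`, and zero elsewhere;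
then `det A_q = (h_q(r₊) − h_q(r₋) + p₂(r₊^q − r₋^q))/√(p₀² − p₁²)` with
`r_± = (p₀ ± √(p₀² − p₁²))/2` and `h_n(x) = p₀x^n − (p₁²/4)x^{n−1}`. -/
theorem tridiagonal_det (q : ℕ) (hq : 1 ≤ q) (p₀ p₁ p₂ : ℝ)
    (h₁ : 0 ≤ p₁) (h₀ : p₁ < p₀) (h₂ : 0 ≤ p₂) :
    Matrix.det (Matrix.of fun i j : Fin q =>
        if i = j then (if (i : ℕ) = q - 1 then p₀ + p₂ else p₀)
        else if (i : ℕ) + 1 = (j : ℕ) ∨ (j : ℕ) + 1 = (i : ℕ) then p₁ / 2 else 0) =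
      (p₀ * ((p₀ + Real.sqrt (p₀ ^ 2 - p₁ ^ 2)) / 2) ^ q -
          p₁ ^ 2 / 4 * ((p₀ + Real.sqrt (p₀ ^ 2 - p₁ ^ 2)) / 2) ^ (q - 1) -
        (p₀ * ((p₀ - Real.sqrt (p₀ ^ 2 - p₁ ^ 2)) / 2) ^ q -
          p₁ ^ 2 / 4 * ((p₀ - Real.sqrt (p₀ ^ 2 - p₁ ^ 2)) / 2) ^ (q - 1)) +
        p₂ * (((p₀ + Real.sqrt (p₀ ^ 2 - p₁ ^ 2)) / 2) ^ q -
          ((p₀ - Real.sqrt (p₀ ^ 2 - p₁ ^ 2)) / 2) ^ q)) /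
      Real.sqrt (p₀ ^ 2 - p₁ ^ 2) := by
  obtain ⟨n, rfl⟩ := Nat.exists_eq_add_of_le' hq
  have hd : 0 < p₀ ^ 2 - p₁ ^ 2 := by nlinarith
  have hs := Real.sqrt_pos.mpr hd
  have hsq := Real.sq_sqrt hd.le
  set d := Real.sqrt (p₀ ^ 2 - p₁ ^ 2)
  have key := sub_mul_det_tridiagonalMatrix (p₁ / 2) p₂ ((p₀ + d) / 2) ((p₀ - d) / 2)
    (by linear_combination -hsq / 4) n
  have hsum : (p₀ + d) / 2 + (p₀ - d) / 2 = p₀ := by ring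
  have hdiff : (p₀ + d) / 2 - (p₀ - d) / 2 = d := by ring
  have hb : (p₁ / 2) ^ 2 = p₁ ^ 2 / 4 := by ring
  rw [hsum, hdiff, hb] at key
  rw [eq_div_iff hs.ne', mul_comm]
  exact key
end

section
/- Biorthogonality of the kernel building blocks: let γ ≥ 0 and let E(w) := e^{γ(w−1)} (an entire, nowhere-vanishing function). Fix n ≥ 1 and 1 ≤ k, l ≤ r_n. Define Ψ^n_{r_n−k}(s) := ⟨J_{s,α_n}, (x−1)^{r_n−k}·E⟩_{α_n} and Φ^n_{r_n−l}(s) := (1/(2πi))·∮_{|w|=2} J_{s,α_n}(w)/(E(w)·(w−1)^{r_n−l+1}) dw, the integral over the positively oriented circle of radius 2 centered at 0. Then ∑_{s=0}^{∞} Ψ^n_{r_n−k}(s)·Φ^n_{r_n−l}(s) converges and equals δ_{kl}. -/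
open MeasureTheory Real

/-- Chebyshev polynomials of the second and third kind at complex arguments. -/
noncomputable def chebJC (α : ℝ) : ℕ → ℂ → ℂ
  | 0, _ => 1
  | 1, z => if α = 1 / 2 then 2 * z else 2 * z - 1
  | n + 2, z => 2 * z * chebJC α (n + 1) z - chebJC α n z

/-- The correction in `chebJ α 1 x = 2 * x - jacobiShift α`. -/
noncomputable def jacobiShift (α : ℝ) : ℝ := if α = 1 / 2 then 0 else 1

/-- The normalized Jacobi weight divided by the arcsine weight `(1 - x ^ 2) ^ (-1 / 2)`. -/
noncomputable def arcsineDensity (α x : ℝ) : ℝ := if α = 1 / 2 then 2 * (1 - x ^ 2) else 1 + x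

/-- The coefficients of `(x - 1) ^ M` in the Chebyshev basis. -/
noncomputable def powCoeff (α : ℝ) (M s : ℕ) : ℝ :=
  innerJ α (chebJ α s) (fun x => (x - 1) ^ M)

theorem chebJ_one (α x : ℝ) : chebJ α 1 x = 2 * x - jacobiShift α := by
  simp only [chebJ, jacobiShift]; split_ifs <;> ring

theorem chebJC_one (α : ℝ) (z : ℂ) : chebJC α 1 z = 2 * z - jacobiShift α := by
  simp only [chebJC, jacobiShift]; split_ifs <;> simp

theorem jacobiShift_nonneg (α : ℝ) : 0 ≤ jacobiShift α := by
  unfold jacobiShift; split_ifs <;> norm_num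

theorem jacobiShift_le_one (α : ℝ) : jacobiShift α ≤ 1 := by
  unfold jacobiShift; split_ifs <;> norm_num

theorem continuous_chebJ (α : ℝ) (s : ℕ) : Continuous (chebJ α s) := by
  induction s using Nat.twoStepInduction with
  | zero => exact continuous_const
  | one =>
    rw [show chebJ α 1 = fun x => 2 * x - jacobiShift α from funext (chebJ_one α)]
    fun_prop
  | more s h₀ h₁ =>
    change Continuous fun x => 2 * x * chebJ α (s + 1) x - chebJ α s x
    fun_prop

theorem continuous_chebJC (α : ℝ) (s : ℕ) : Continuous (chebJC α s) := by
  induction s using Nat.twoStepInduction with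
  | zero => exact continuous_const
  | one =>
    rw [show chebJC α 1 = fun z => 2 * z - (jacobiShift α : ℂ) from funext (chebJC_one α)]
    fun_prop
  | more s h₀ h₁ =>
    change Continuous fun z => 2 * z * chebJC α (s + 1) z - chebJC α s z
    fun_prop

theorem continuous_arcsineDensity (α : ℝ) : Continuous (arcsineDensity α) := by
  unfold arcsineDensity; split_ifs <;> fun_prop

theorem norm_chebJC_le (α : ℝ) (s : ℕ) {w : ℂ} (hw : ‖w‖ ≤ 2) : ‖chebJC α s w‖ ≤ 5 ^ s := by
  induction s using Nat.twoStepInduction with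
  | zero => simp [chebJC]
  | one =>
    rw [chebJC_one]
    calc ‖2 * w - (jacobiShift α : ℂ)‖ ≤ ‖2 * w‖ + ‖(jacobiShift α : ℂ)‖ := norm_sub_le _ _
      _ = 2 * ‖w‖ + jacobiShift α := by
        simp [abs_of_nonneg (jacobiShift_nonneg α)]
      _ ≤ 5 ^ 1 := by linarith [jacobiShift_le_one α]
  | more s h₀ h₁ =>
    calc ‖2 * w * chebJC α (s + 1) w - chebJC α s w‖
        ≤ ‖2 * w * chebJC α (s + 1) w‖ + ‖chebJC α s w‖ := norm_sub_le _ _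
      _ = 2 * ‖w‖ * ‖chebJC α (s + 1) w‖ + ‖chebJC α s w‖ := by simp
      _ ≤ 2 * 2 * 5 ^ (s + 1) + 5 ^ s := by gcongr
      _ ≤ 5 ^ (s + 2) := by
        have : (0 : ℝ) < 5 ^ s := by positivity
        rw [pow_succ, pow_add]; linarith

theorem innerJ_eq_integral_cos {α : ℝ} (hα : α = 1 / 2 ∨ α = -(1 / 2)) (f g : ℝ → ℝ) :
    innerJ α f g =
      1 / π * ∫ θ in (0 : ℝ)..π, f (cos θ) * g (cos θ) * arcsineDensity α (cos θ) := by
  rw [← Polynomial.Chebyshev.integral_measureT_eq_integral_cos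
    (f := fun x => f x * g x * arcsineDensity α x), Polynomial.Chebyshev.integral_measureT, innerJ,
    div_mul_eq_mul_div, one_div_mul_eq_div, ← intervalIntegral.integral_const_mul]
  congr 1
  refine intervalIntegral.integral_congr fun x hx => ?_
  rw [Set.uIcc_of_le (by norm_num)] at hx
  have h₁ : 0 ≤ 1 - x := by linarith [hx.2]
  have h₂ : 0 ≤ 1 + x := by linarith [hx.1]
  have h : √(1 - x ^ 2)⁻¹ = (√(1 - x) * √(1 + x))⁻¹ := by
    rw [Real.sqrt_inv, ← Real.sqrt_mul h₁]; ring_nf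
  have hu := Real.sq_sqrt h₁
  have hv := Real.sq_sqrt h₂
  simp only [h, ← Real.sqrt_eq_rpow]
  rcases hα with rfl | rfl
  · rw [← Real.sqrt_eq_rpow, show arcsineDensity (1 / 2) x = 2 * (√(1 - x) ^ 2 * √(1 + x) ^ 2) by
      rw [hu, hv]; simp only [arcsineDensity, if_true]; ring]
    rcases eq_or_ne √(1 - x) 0 with hu0 | hu0
    · simp [hu0]
    rcases eq_or_ne √(1 + x) 0 with hv0 | hv0
    · simp [hv0]
    norm_num
    field_simp
  · rw [Real.rpow_neg h₁, ← Real.sqrt_eq_rpow, show arcsineDensity (-(1 / 2)) x = √(1 + x) ^ 2 by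
      rw [hv]; unfold arcsineDensity; rw [if_neg (by norm_num)]]
    rcases eq_or_ne √(1 + x) 0 with hv0 | hv0
    · simp [hv0]
    rcases eq_or_ne √(1 - x) 0 with hu0 | hu0
    · simp [hu0]
    norm_num
    field_simp

theorem cos_nat_add_two_mul (m : ℕ) (θ : ℝ) :
    cos ((m + 2 : ℕ) * θ) = 2 * cos θ * cos ((m + 1 : ℕ) * θ) - cos (m * θ) := by
  have := cos_add_cos ((m + 2 : ℕ) * θ) (m * θ)
  rw [show ((m + 2 : ℕ) * θ + m * θ) / 2 = (m + 1 : ℕ) * θ by push_cast; ring,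
    show ((m + 2 : ℕ) * θ - m * θ) / 2 = θ by push_cast; ring] at this
  linarith

theorem chebJ_half_cos_mul_arcsineDensity (s : ℕ) (θ : ℝ) :
    chebJ (1 / 2) s (cos θ) * arcsineDensity (1 / 2) (cos θ) =
      cos (s * θ) - cos ((s + 2 : ℕ) * θ) := by
  simp only [arcsineDensity, if_true]
  induction s using Nat.twoStepInduction with
  | zero => simp [chebJ, cos_two_mul]; ring
  | one =>
    have := cos_three_mul θ
    simp [chebJ]; norm_num [this]; ring
  | more s h₀ h₁ =>
    have e₀ := cos_nat_add_two_mul s θ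
    have e₁ := cos_nat_add_two_mul (s + 2) θ
    rw [show chebJ (1 / 2) (s + 2) (cos θ) =
      2 * cos θ * chebJ (1 / 2) (s + 1) (cos θ) - chebJ (1 / 2) s (cos θ) from rfl]
    linear_combination 2 * cos θ * h₁ - h₀ - e₀ + e₁

theorem chebJ_neg_half_cos_mul_arcsineDensity (s : ℕ) (θ : ℝ) :
    chebJ (-(1 / 2)) s (cos θ) * arcsineDensity (-(1 / 2)) (cos θ) =
      cos (s * θ) + cos ((s + 1 : ℕ) * θ) := by
  have hne : ¬ (-(1 / 2) : ℝ) = 1 / 2 := by norm_num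
  simp only [arcsineDensity, if_neg hne]
  induction s using Nat.twoStepInduction with
  | zero => simp [chebJ]
  | one =>
    simp only [chebJ, if_neg hne]; norm_num [cos_two_mul]; ring
  | more s h₀ h₁ =>
    have e₀ := cos_nat_add_two_mul s θ
    have e₁ := cos_nat_add_two_mul (s + 1) θ
    rw [show chebJ (-(1 / 2)) (s + 2) (cos θ) =
      2 * cos θ * chebJ (-(1 / 2)) (s + 1) (cos θ) - chebJ (-(1 / 2)) s (cos θ) from rfl]
    linear_combination 2 * cos θ * h₁ - h₀ - e₀ - e₁

theorem integral_cos_nat_mul {s : ℕ} (hs : s ≠ 0) : ∫ θ in (0 : ℝ)..π, cos (s * θ) = 0 := by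
  rw [intervalIntegral.integral_comp_mul_left (fun x => cos x) (Nat.cast_ne_zero.mpr hs)]
  simp

theorem powCoeff_zero_left {α : ℝ} (hα : α = 1 / 2 ∨ α = -(1 / 2)) (s : ℕ) :
    powCoeff α 0 s = if s = 0 then 1 else 0 := by
  rw [powCoeff, innerJ_eq_integral_cos hα]
  simp only [pow_zero, mul_one]
  have hi (m : ℕ) : IntervalIntegrable (fun θ : ℝ => cos (m * θ)) volume 0 π :=
    Continuous.intervalIntegrable (by fun_prop) _ _
  have key : ∫ θ in (0 : ℝ)..π, chebJ α s (cos θ) * arcsineDensity α (cos θ) =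
      ∫ θ in (0 : ℝ)..π, cos (s * θ) := by
    rcases hα with rfl | rfl
    · simp_rw [chebJ_half_cos_mul_arcsineDensity]
      rw [intervalIntegral.integral_sub (hi _) (hi _),
        integral_cos_nat_mul (Nat.succ_ne_zero (s + 1)), sub_zero]
    · simp_rw [chebJ_neg_half_cos_mul_arcsineDensity]
      rw [intervalIntegral.integral_add (hi _) (hi _),
        integral_cos_nat_mul (Nat.succ_ne_zero s), add_zero]
  rw [key]
  split_ifs with hs
  · simp [hs, pi_ne_zero]
  · rw [integral_cos_nat_mul hs, mul_zero]

theorem innerJ_linear {α : ℝ} (hα : α = 1 / 2 ∨ α = -(1 / 2)) {f f₁ f₂ f₃ g h : ℝ → ℝ} {c : ℝ}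
    (hf₁ : Continuous f₁) (hf₂ : Continuous f₂) (hf₃ : Continuous f₃) (hh : Continuous h)
    (H : ∀ x, f x * g x = (f₁ x / 2 + f₂ x / 2 + c * f₃ x) * h x) :
    innerJ α f g = innerJ α f₁ h / 2 + innerJ α f₂ h / 2 + c * innerJ α f₃ h := by
  have hd := continuous_arcsineDensity α
  have hi {u : ℝ → ℝ} (hu : Continuous u) : IntervalIntegrable
      (fun θ : ℝ => u (cos θ) * h (cos θ) * arcsineDensity α (cos θ)) volume 0 π :=
    Continuous.intervalIntegrable (by fun_prop) _ _
  simp only [innerJ_eq_integral_cos hα, H]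
  have e (θ : ℝ) : (f₁ (cos θ) / 2 + f₂ (cos θ) / 2 + c * f₃ (cos θ)) * h (cos θ) *
      arcsineDensity α (cos θ) =
      1 / 2 * (f₁ (cos θ) * h (cos θ) * arcsineDensity α (cos θ)) +
      1 / 2 * (f₂ (cos θ) * h (cos θ) * arcsineDensity α (cos θ)) +
      c * (f₃ (cos θ) * h (cos θ) * arcsineDensity α (cos θ)) := by ring
  simp_rw [e]
  rw [intervalIntegral.integral_add (((hi hf₁).const_mul _).add ((hi hf₂).const_mul _))
      ((hi hf₃).const_mul _),
    intervalIntegral.integral_add ((hi hf₁).const_mul _) ((hi hf₂).const_mul _)]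
  simp only [intervalIntegral.integral_const_mul]
  ring

theorem powCoeff_succ_zero {α : ℝ} (hα : α = 1 / 2 ∨ α = -(1 / 2)) (M : ℕ) :
    powCoeff α (M + 1) 0 =
      powCoeff α M 1 / 2 + jacobiShift α * powCoeff α M 0 / 2 - powCoeff α M 0 := by
  rw [powCoeff, innerJ_linear hα (h := fun x => (x - 1) ^ M) (c := jacobiShift α / 2 - 3 / 2)
    (continuous_chebJ α 1) (continuous_chebJ α 0) (continuous_chebJ α 0) (by fun_prop)
    fun x => by simp only [chebJ_one, show chebJ α 0 x = 1 from rfl]; ring]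
  simp only [powCoeff]; ring

theorem powCoeff_succ_succ {α : ℝ} (hα : α = 1 / 2 ∨ α = -(1 / 2)) (M s : ℕ) :
    powCoeff α (M + 1) (s + 1) =
      powCoeff α M (s + 2) / 2 + powCoeff α M s / 2 - powCoeff α M (s + 1) := by
  rw [powCoeff, innerJ_linear hα (h := fun x => (x - 1) ^ M) (c := -1)
    (continuous_chebJ α (s + 2)) (continuous_chebJ α s) (continuous_chebJ α (s + 1)) (by fun_prop)
    fun x => by
      rw [show chebJ α (s + 2) x = 2 * x * chebJ α (s + 1) x - chebJ α s x from rfl]; ring]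
  simp only [powCoeff]; ring

theorem abs_powCoeff_le {α : ℝ} (hα : α = 1 / 2 ∨ α = -(1 / 2)) (M s : ℕ) :
    |powCoeff α M s| ≤ 7 ^ M * (1 / 10) ^ s := by
  induction M generalizing s with
  | zero => rw [powCoeff_zero_left hα]; split_ifs with hs <;> simp [hs]
  | succ M ih =>
    have hM : (0 : ℝ) < 7 ^ M := by positivity
    cases s with
    | zero =>
      have h₀ := abs_le.mp (ih 0)
      have h₁ := abs_le.mp (ih 1)
      rw [powCoeff_succ_zero hα]
      have : jacobiShift α = 0 ∨ jacobiShift α = 1 := by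
        unfold jacobiShift; split_ifs <;> simp
      rw [abs_le, pow_succ]
      rcases this with h | h <;> rw [h] <;> constructor <;> linarith [h₀.1, h₀.2, h₁.1, h₁.2]
    | succ s =>
      have hs : (0 : ℝ) < 7 ^ M * (1 / 10) ^ s := by positivity
      have h₀ := abs_le.mp (ih s)
      have h₁ := abs_le.mp (ih (s + 1))
      have h₂ := abs_le.mp (ih (s + 2))
      rw [powCoeff_succ_succ hα]
      simp only [pow_succ _ (s + 1), pow_succ _ s, pow_succ _ M] at *
      rw [abs_le]
      constructor <;> linarith [h₀.1, h₀.2, h₁.1, h₁.2, h₂.1, h₂.2]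

theorem norm_powCoeff_mul_chebJC_le {α : ℝ} (hα : α = 1 / 2 ∨ α = -(1 / 2)) (M s : ℕ) {w : ℂ}
    (hw : ‖w‖ ≤ 2) : ‖(powCoeff α M s : ℂ) * chebJC α s w‖ ≤ 7 ^ M * (1 / 2) ^ s := by
  rw [norm_mul, Complex.norm_real, Real.norm_eq_abs]
  calc _ ≤ 7 ^ M * (1 / 10) ^ s * 5 ^ s :=
        mul_le_mul (abs_powCoeff_le hα M s) (norm_chebJC_le α s hw) (norm_nonneg _) (by positivity)
    _ = 7 ^ M * (1 / 2) ^ s := by rw [mul_assoc, ← mul_pow]; norm_num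

/-- A Christoffel-Darboux type telescoping identity for the partial Chebyshev sums. -/
theorem sum_powCoeff_succ {α : ℝ} (hα : α = 1 / 2 ∨ α = -(1 / 2)) (M N : ℕ) (w : ℂ) :
    ∑ s ∈ Finset.range (N + 1), (powCoeff α (M + 1) s : ℂ) * chebJC α s w =
      (w - 1) * ∑ s ∈ Finset.range (N + 1), (powCoeff α M s : ℂ) * chebJC α s w +
      (powCoeff α M (N + 1) * chebJC α N w - powCoeff α M N * chebJC α (N + 1) w) / 2 := by
  induction N with
  | zero =>
    simp only [zero_add, Finset.sum_range_one, powCoeff_succ_zero hα, chebJC_one,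
      show chebJC α 0 w = 1 from rfl]
    push_cast; ring
  | succ N ih =>
    rw [Finset.sum_range_succ, ih, Finset.sum_range_succ _ (N + 1), powCoeff_succ_succ hα,
      show chebJC α (N + 1 + 1) w = 2 * w * chebJC α (N + 1) w - chebJC α N w from rfl]
    push_cast; ring

theorem hasSum_powCoeff {α : ℝ} (hα : α = 1 / 2 ∨ α = -(1 / 2)) (M : ℕ) {w : ℂ}
    (hw : ‖w‖ ≤ 2) : HasSum (fun s => (powCoeff α M s : ℂ) * chebJC α s w) ((w - 1) ^ M) := by
  have hsum (M : ℕ) : Summable fun s => (powCoeff α M s : ℂ) * chebJC α s w :=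
    Summable.of_norm_bounded (summable_geometric_two.mul_left (7 ^ M))
      fun s => norm_powCoeff_mul_chebJC_le hα M s hw
  induction M with
  | zero =>
    convert hasSum_ite_eq 0 (1 : ℂ) using 2 with s
    · rw [powCoeff_zero_left hα]
      split_ifs with hs <;> simp [hs, chebJC]
    · simp
  | succ M ih =>
    rw [(hsum (M + 1)).hasSum_iff_tendsto_nat, ← Filter.tendsto_add_atTop_iff_nat 1]
    simp_rw [sum_powCoeff_succ hα]
    have h₁ : Filter.Tendsto (fun N => (powCoeff α M (N + 1) : ℂ) * chebJC α N w)
        Filter.atTop (nhds 0) := by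
      refine squeeze_zero_norm (a := fun N : ℕ => 7 ^ M * (1 / 2 : ℝ) ^ N) (fun N => ?_) ?_
      · rw [norm_mul, Complex.norm_real, Real.norm_eq_abs]
        calc _ ≤ 7 ^ M * (1 / 10) ^ (N + 1) * 5 ^ N := mul_le_mul (abs_powCoeff_le hα M _)
              (norm_chebJC_le α N hw) (norm_nonneg _) (by positivity)
          _ ≤ 7 ^ M * (1 / 10) ^ N * 5 ^ N := by
            gcongr 7 ^ M * ?_ * 5 ^ N
            exact pow_le_pow_of_le_one (by norm_num) (by norm_num) (Nat.le_succ N)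
          _ = 7 ^ M * (1 / 2) ^ N := by rw [mul_assoc, ← mul_pow]; norm_num
      · simpa using (tendsto_pow_atTop_nhds_zero_of_lt_one (r := (1 / 2 : ℝ))
          (by norm_num) (by norm_num)).const_mul (7 ^ M : ℝ)
    have h₂ : Filter.Tendsto (fun N => (powCoeff α M N : ℂ) * chebJC α (N + 1) w)
        Filter.atTop (nhds 0) := by
      refine squeeze_zero_norm (a := fun N : ℕ => 7 ^ M * 5 * (1 / 2 : ℝ) ^ N) (fun N => ?_) ?_
      · rw [norm_mul, Complex.norm_real, Real.norm_eq_abs]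
        calc _ ≤ 7 ^ M * (1 / 10) ^ N * 5 ^ (N + 1) := mul_le_mul (abs_powCoeff_le hα M _)
              (norm_chebJC_le α (N + 1) hw) (norm_nonneg _) (by positivity)
          _ = 7 ^ M * 5 * ((1 / 10) ^ N * 5 ^ N) := by ring
          _ = 7 ^ M * 5 * (1 / 2) ^ N := by rw [← mul_pow]; norm_num
      · simpa using (tendsto_pow_atTop_nhds_zero_of_lt_one (r := (1 / 2 : ℝ))
          (by norm_num) (by norm_num)).const_mul (7 ^ M * 5 : ℝ)
    have h₃ := (Filter.tendsto_add_atTop_iff_nat 1).mpr ih.tendsto_sum_nat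
    simpa [pow_succ, mul_comm] using (h₃.const_mul (w - 1)).add ((h₁.sub h₂).div_const 2)

theorem hasSum_pow_mul_exp (γ : ℝ) (a : ℕ) (x : ℝ) :
    HasSum (fun m : ℕ => γ ^ m / m.factorial * (x - 1) ^ (a + m))
      ((x - 1) ^ a * exp (γ * (x - 1))) := by
  have := (NormedSpace.expSeries_div_hasSum_exp (𝔸 := ℝ) (γ * (x - 1))).mul_left ((x - 1) ^ a)
  rw [← Real.exp_eq_exp_ℝ] at this
  refine this.congr_fun fun m => ?_
  rw [mul_pow, pow_add]; ring

theorem hasSum_pow_mul_cexp (γ : ℝ) (a : ℕ) (w : ℂ) :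
    HasSum (fun m : ℕ => (γ : ℂ) ^ m / m.factorial * (w - 1) ^ (a + m))
      ((w - 1) ^ a * Complex.exp (γ * (w - 1))) := by
  have := (NormedSpace.expSeries_div_hasSum_exp (𝔸 := ℂ) (γ * (w - 1))).mul_left ((w - 1) ^ a)
  rw [← Complex.exp_eq_exp_ℂ] at this
  refine this.congr_fun fun m => ?_
  rw [mul_pow, pow_add]; ring

theorem hasSum_innerJ_pow_mul_exp {α : ℝ} (hα : α = 1 / 2 ∨ α = -(1 / 2)) (γ : ℝ) (a s : ℕ) :
    HasSum (fun m : ℕ => γ ^ m / m.factorial * powCoeff α (a + m) s)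
      (innerJ α (chebJ α s) fun x => (x - 1) ^ a * exp (γ * (x - 1))) := by
  have hd := continuous_arcsineDensity α
  have hJ := continuous_chebJ α s
  simp only [powCoeff, innerJ_eq_integral_cos hα]
  have e (m : ℕ) : γ ^ m / m.factorial * (1 / π * ∫ θ in (0 : ℝ)..π,
      chebJ α s (cos θ) * (cos θ - 1) ^ (a + m) * arcsineDensity α (cos θ)) =
      1 / π * ∫ θ in (0 : ℝ)..π, γ ^ m / m.factorial * (cos θ - 1) ^ (a + m) *
        (chebJ α s (cos θ) * arcsineDensity α (cos θ)) := by
    rw [mul_left_comm, ← intervalIntegral.integral_const_mul]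
    congr 2; ext θ; ring
  simp_rw [e]
  refine HasSum.mul_left _ ?_
  have hs : Summable fun m : ℕ => (2 : ℝ) ^ a * ((2 * |γ|) ^ m / m.factorial) :=
    (Real.summable_pow_div_factorial _).mul_left _
  refine intervalIntegral.hasSum_integral_of_dominated_convergence
    (fun m θ => 2 ^ a * ((2 * |γ|) ^ m / m.factorial) *
      |chebJ α s (cos θ) * arcsineDensity α (cos θ)|) (fun m => ?_) (fun m => ?_) ?_ ?_ ?_
  · exact Continuous.aestronglyMeasurable (by fun_prop)
  · refine .of_forall fun θ _ => ?_
    rw [Real.norm_eq_abs, abs_mul]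
    gcongr
    rw [abs_mul, abs_div, abs_pow, abs_pow, Nat.abs_cast]
    have : |cos θ - 1| ≤ 2 := by
      rw [abs_le]; constructor <;> linarith [neg_one_le_cos θ, cos_le_one θ]
    calc |γ| ^ m / m.factorial * |cos θ - 1| ^ (a + m)
        ≤ |γ| ^ m / m.factorial * 2 ^ (a + m) := by gcongr
      _ = 2 ^ a * ((2 * |γ|) ^ m / m.factorial) := by rw [mul_pow, pow_add]; ring
  · exact .of_forall fun θ _ => hs.mul_right _
  · simp_rw [tsum_mul_right]
    exact Continuous.intervalIntegrable (by fun_prop) _ _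
  · refine .of_forall fun θ _ => ?_
    rw [show chebJ α s (cos θ) * ((cos θ - 1) ^ a * exp (γ * (cos θ - 1))) *
      arcsineDensity α (cos θ) = (cos θ - 1) ^ a * exp (γ * (cos θ - 1)) *
      (chebJ α s (cos θ) * arcsineDensity α (cos θ)) by ring]
    exact (hasSum_pow_mul_exp γ a (cos θ)).mul_right _

theorem summable_norm_exp_coeff (γ : ℝ) (a : ℕ) :
    Summable fun m : ℕ => |γ| ^ m / m.factorial * (7 : ℝ) ^ (a + m) := by
  refine ((Real.summable_pow_div_factorial (7 * |γ|)).mul_left (7 ^ a)).congr fun m => ?_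
  rw [mul_pow, pow_add]; ring

/-- The Chebyshev coefficients of `(x - 1) ^ a * exp (γ * (x - 1))` decay geometrically. -/
theorem exists_abs_innerJ_le {α : ℝ} (hα : α = 1 / 2 ∨ α = -(1 / 2)) (γ : ℝ) (a : ℕ) :
    ∃ C, ∀ s, |innerJ α (chebJ α s) fun x => (x - 1) ^ a * exp (γ * (x - 1))| ≤
      C * (1 / 10) ^ s := by
  refine ⟨∑' m : ℕ, |γ| ^ m / m.factorial * (7 : ℝ) ^ (a + m), fun s => ?_⟩
  have h := (summable_norm_exp_coeff γ a).hasSum.mul_right ((1 / 10 : ℝ) ^ s)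
  rw [← Real.norm_eq_abs, ← (hasSum_innerJ_pow_mul_exp hα γ a s).tsum_eq]
  refine tsum_of_norm_bounded h fun m => ?_
  rw [Real.norm_eq_abs, abs_mul, abs_div, abs_pow, Nat.abs_cast, mul_assoc (|γ| ^ m / _)]
  gcongr
  exact abs_powCoeff_le hα _ _

theorem hasSum_of_summable_prod {F : ℕ × ℕ → ℂ} {r c : ℕ → ℂ} {t : ℂ} (hF : Summable F)
    (hr : ∀ m, HasSum (fun s => F (m, s)) (r m)) (ht : HasSum r t)
    (hc : ∀ s, HasSum (fun m => F (m, s)) (c s)) : HasSum c t := by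
  have hswap : HasSum (fun p : ℕ × ℕ => F p.swap) (∑' p, F p) :=
    (Equiv.prodComm ℕ ℕ).hasSum_iff.mpr hF.hasSum
  rw [← (hF.hasSum.prod_fiberwise hr).unique ht]
  exact hswap.prod_fiberwise hc

/-- Chebyshev expansion of `(w - 1) ^ a * exp (γ * (w - 1))` on the disc of radius `2`. -/
theorem hasSum_innerJ_mul_chebJC {α : ℝ} (hα : α = 1 / 2 ∨ α = -(1 / 2)) (γ : ℝ) (a : ℕ) {w : ℂ}
    (hw : ‖w‖ ≤ 2) :
    HasSum (fun s => (innerJ α (chebJ α s) (fun x => (x - 1) ^ a * exp (γ * (x - 1))) : ℂ) *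
      chebJC α s w) ((w - 1) ^ a * Complex.exp (γ * (w - 1))) := by
  have hrow (m : ℕ) : HasSum (fun s => (γ : ℂ) ^ m / m.factorial *
      ((powCoeff α (a + m) s : ℂ) * chebJC α s w)) (γ ^ m / m.factorial * (w - 1) ^ (a + m)) :=
    HasSum.mul_left ((γ : ℂ) ^ m / m.factorial) (hasSum_powCoeff hα (a + m) hw)
  refine hasSum_of_summable_prod (F := fun p =>
    (γ : ℂ) ^ p.1 / p.1.factorial * ((powCoeff α (a + p.1) p.2 : ℂ) * chebJC α p.2 w)) ?_
    hrow (hasSum_pow_mul_cexp γ a w) fun s => ?_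
  · have hu : Summable fun p : ℕ × ℕ =>
        |γ| ^ p.1 / p.1.factorial * (7 : ℝ) ^ (a + p.1) * (1 / 2 : ℝ) ^ p.2 :=
      (summable_norm_exp_coeff γ a).mul_of_nonneg summable_geometric_two
        (fun m => by simp only [Pi.zero_apply]; positivity)
        (fun s => by simp only [Pi.zero_apply]; positivity)
    refine Summable.of_norm_bounded hu fun p => ?_
    rw [norm_mul, norm_div, norm_pow, Complex.norm_real, Complex.norm_natCast, Real.norm_eq_abs,
      mul_assoc]
    gcongr
    exact norm_powCoeff_mul_chebJC_le hα _ _ hw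
  · have := (Complex.hasSum_ofReal.mpr (hasSum_innerJ_pow_mul_exp hα γ a s)).mul_right
      (chebJC α s w)
    refine this.congr_fun fun m => ?_
    push_cast
    ring

theorem circleIntegral_pow_div_pow (a b : ℕ) :
    (∮ w in C(0, 2), (w - 1) ^ a / (w - 1 : ℂ) ^ (b + 1)) =
      if a = b then 2 * π * Complex.I else 0 := by
  have e : (∮ w in C(0, 2), (w - 1) ^ a / (w - 1 : ℂ) ^ (b + 1)) =
      ∮ w in C(0, 2), (w - 1 : ℂ) ^ ((a : ℤ) - (b + 1)) := by
    refine circleIntegral.integral_congr (by norm_num) fun w hw => ?_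
    have hne : w - 1 ≠ 0 := by
      rintro h
      rw [sub_eq_zero.mp h] at hw
      norm_num at hw
    simp only [zpow_sub₀ hne]
    norm_cast
  rw [e]
  split_ifs with h
  · subst h
    rw [← circleIntegral.integral_sub_inv_of_mem_ball (c := 0) (w := 1) (R := 2) (by simp)]
    simp
  · exact circleIntegral.integral_sub_zpow_of_ne (by omega) _ _ _

theorem hasSum_circleIntegral_of_norm_le {F : ℕ → ℂ → ℂ} {f : ℂ → ℂ} {c : ℂ} {R : ℝ} {u : ℕ → ℝ}
    (hR : 0 ≤ R) (hF : ∀ s, ContinuousOn (F s) (Metric.sphere c R)) (hu : Summable u)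
    (hb : ∀ s, ∀ w ∈ Metric.sphere c R, ‖F s w‖ ≤ u s)
    (h : ∀ w ∈ Metric.sphere c R, HasSum (fun s => F s w) (f w)) :
    HasSum (fun s => ∮ w in C(c, R), F s w) (∮ w in C(c, R), f w) := by
  refine intervalIntegral.hasSum_integral_of_dominated_convergence (fun s _ => R * u s)
    (fun s => ?_) (fun s => ?_) ?_ ?_ ?_
  · refine Continuous.aestronglyMeasurable ?_
    have := (hF s).comp_continuous (continuous_circleMap c R) fun θ => circleMap_mem_sphere c hR θ
    simp only [deriv_circleMap]
    exact ((continuous_circleMap 0 R).mul continuous_const).smul this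
  · refine .of_forall fun θ _ => ?_
    rw [norm_smul, deriv_circleMap, norm_mul, norm_circleMap_zero, Complex.norm_I, mul_one,
      abs_of_nonneg hR]
    gcongr
    exact hb s _ (circleMap_mem_sphere c hR θ)
  · exact .of_forall fun _ _ => hu.mul_left _
  · exact intervalIntegrable_const
  · exact .of_forall fun θ _ => (h _ (circleMap_mem_sphere c hR θ)).const_smul _

/-- Biorthogonality of the kernel building blocks:
`∑_{s≥0} Ψ^n_{r_n−k}(s)·Φ^n_{r_n−l}(s) = δ_{kl}` with `E(w) = e^{γ(w−1)}`. -/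
theorem kernel_biorthogonality (γ : ℝ) (hγ : 0 ≤ γ) (n : ℕ) (hn : 1 ≤ n)
    (k l : ℕ) (hk : 1 ≤ k) (hk' : k ≤ rr n) (hl : 1 ≤ l) (hl' : l ≤ rr n) :
    HasSum
      (fun s : ℕ =>
        (innerJ (alph n) (chebJ (alph n) s)
            (fun x => (x - 1) ^ (rr n - k) * Real.exp (γ * (x - 1))) : ℂ) *
          ((1 / (2 * (Real.pi : ℂ) * Complex.I)) *
            ∮ w in C(0, 2), chebJC (alph n) s w /
              (Complex.exp ((γ : ℂ) * (w - 1)) * (w - 1) ^ (rr n - l + 1))))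
      (if k = l then 1 else 0) := by
  have hα := alph_eq n
  set a := rr n - k with ha
  set b := rr n - l with hb
  set D : ℂ → ℂ := fun w => Complex.exp (γ * (w - 1)) * (w - 1) ^ (b + 1) with hD
  have hne : ∀ w ∈ Metric.sphere (0 : ℂ) 2, w - 1 ≠ 0 := by
    rintro w hw h
    rw [sub_eq_zero.mp h] at hw
    norm_num at hw
  have hD0 : ∀ w ∈ Metric.sphere (0 : ℂ) 2, D w ≠ 0 := fun w hw =>
    mul_ne_zero (Complex.exp_ne_zero _) (pow_ne_zero _ (hne w hw))
  have hDinv : ContinuousOn (fun w => (D w)⁻¹) (Metric.sphere 0 2) :=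
    ContinuousOn.inv₀ (by fun_prop) hD0
  obtain ⟨B, hB⟩ := (isCompact_sphere (0 : ℂ) 2).exists_bound_of_continuousOn hDinv
  obtain ⟨C, hC⟩ := exists_abs_innerJ_le hα γ a
  have key := hasSum_circleIntegral_of_norm_le (c := 0) (R := 2) (u := fun s => C * B * (1 / 2) ^ s)
    (F := fun s w => (innerJ (alph n) (chebJ (alph n) s)
      (fun x => (x - 1) ^ a * Real.exp (γ * (x - 1))) : ℂ) * chebJC (alph n) s w * (D w)⁻¹)
    (f := fun w => (w - 1) ^ a * Complex.exp (γ * (w - 1)) * (D w)⁻¹) (by norm_num)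
    (fun s => (continuous_const.mul (continuous_chebJC _ s)).continuousOn.mul hDinv)
    (summable_geometric_two.mul_left _)
    (fun s w hw => by
      have hw2 : ‖w‖ ≤ 2 := (mem_sphere_zero_iff_norm.mp hw).le
      rw [norm_mul, norm_mul, Complex.norm_real, Real.norm_eq_abs]
      have hCs := (abs_nonneg _).trans (hC s)
      calc _ ≤ C * (1 / 10) ^ s * 5 ^ s * B :=
            mul_le_mul (mul_le_mul (hC s) (norm_chebJC_le _ s hw2) (norm_nonneg _) hCs) (hB w hw)
              (norm_nonneg _) (mul_nonneg hCs (by positivity))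
        _ = C * B * ((1 / 10) ^ s * 5 ^ s) := by ring
        _ = C * B * (1 / 2) ^ s := by rw [← mul_pow]; norm_num)
    (fun w hw => (hasSum_innerJ_mul_chebJC hα γ a (mem_sphere_zero_iff_norm.mp hw).le).mul_right _)
  have hval : (∮ w in C(0, 2), (w - 1) ^ a * Complex.exp (γ * (w - 1)) * (D w)⁻¹) =
      if a = b then 2 * π * Complex.I else 0 := by
    rw [← circleIntegral_pow_div_pow]
    refine circleIntegral.integral_congr (by norm_num) fun w hw => ?_
    have h₁ := hne w hw
    have h₂ := Complex.exp_ne_zero (γ * (w - 1))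
    simp only [hD]
    field_simp
  rw [hval] at key
  have hπ : (2 * (π : ℂ) * Complex.I) ≠ 0 := Complex.two_pi_I_ne_zero
  have hkl : (1 / (2 * (π : ℂ) * Complex.I) * if a = b then 2 * π * Complex.I else 0) =
      if k = l then 1 else 0 := by
    have : k = l ↔ a = b := by omega
    simp only [this, mul_ite, one_div_mul_cancel hπ, mul_zero]
  rw [← hkl]
  refine (key.mul_left (1 / (2 * (π : ℂ) * Complex.I))).congr_fun fun s => ?_
  simp only [mul_assoc, div_eq_mul_inv, hD, circleIntegral.integral_const_mul]
  ring
end
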